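/- Let H be a complex Hilbert space, T a bounded linear operator on H, and ρ ≥ 1. Suppose T is a ρ-contraction, i.e., there exist a complex Hilbert space K, an isometry V : H → K, and a unitary operator U on K such that Tⁿ = ρ · V* Uⁿ V for all integers n ≥ 1. Then for every m ≥ 1 and every m×m matrix polynomial F, w(F(T)) ≤ (1/2)(ρ + ρ⁻¹) · ‖F‖_{D̄}, where D̄ is the closed unit disc in ℂ. -/

import Mathlib

open scoped InnerProductSpace
open ContinuousLinearMap Polynomial

noncomputable section

/-- The numerical radius `w(X) = sup { |⟨X x, x⟩| : ‖x‖ = 1 }` of a bounded operator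
on a complex inner product space. (Here `⟪x, X x⟫_ℂ` is the mathematicians'
`⟨X x, x⟩`, since Mathlib's inner product is conjugate-linear in the first slot.) -/
def numRadius {E : Type*} [NormedAddCommGroup E] [InnerProductSpace ℂ E]
    (X : E →L[ℂ] E) : ℝ :=
  sSup {r : ℝ | ∃ x : E, ‖x‖ = 1 ∧ r = ‖(⟪x, X x⟫_ℂ : ℂ)‖}

/-- The numerical range `W(X) = { ⟨X x, x⟩ : ‖x‖ = 1 }` of a bounded operator
on a complex inner product space. (Here `⟪x, X x⟫_ℂ` is the mathematicians'
`⟨X x, x⟩`, since Mathlib's inner product is conjugate-linear in the first slot.) -/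
def numRange {E : Type*} [NormedAddCommGroup E] [InnerProductSpace ℂ E]
    (X : E →L[ℂ] E) : Set ℂ :=
  {z : ℂ | ∃ x : E, ‖x‖ = 1 ∧ z = ⟪x, X x⟫_ℂ}

/-- The 2×2 block operator `[[A, B], [C, D]]` acting on the Hilbert space
direct sum `H ⊕₂ H`. -/
def blockOp {H : Type*} [NormedAddCommGroup H] [InnerProductSpace ℂ H]
    (A B C D : H →L[ℂ] H) : WithLp 2 (H × H) →L[ℂ] WithLp 2 (H × H) :=
  ((WithLp.prodContinuousLinearEquiv 2 ℂ H H).symm :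
      (H × H) →L[ℂ] WithLp 2 (H × H)) ∘L
    ((A ∘L fst ℂ H H + B ∘L snd ℂ H H).prod (C ∘L fst ℂ H H + D ∘L snd ℂ H H)) ∘L
    ((WithLp.prodContinuousLinearEquiv 2 ℂ H H) : WithLp 2 (H × H) →L[ℂ] (H × H))

/-- Evaluation of an `n × n` matrix polynomial `F = (p_{ij})` at an operator `T`:
the block operator `(p_{ij}(T))` acting on the `n`-fold Hilbert direct sum `Hⁿ`. -/
def matPolyEval {H : Type*} [NormedAddCommGroup H] [InnerProductSpace ℂ H]
    {n : ℕ} (T : H →L[ℂ] H)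
    (F : Matrix (Fin n) (Fin n) (Polynomial ℂ)) :
    (PiLp 2 fun _ : Fin n => H) →L[ℂ] (PiLp 2 fun _ : Fin n => H) :=
  ((PiLp.continuousLinearEquiv 2 ℂ fun _ : Fin n => H).symm :
      (Fin n → H) →L[ℂ] PiLp 2 fun _ : Fin n => H) ∘L
    (pi fun i => ∑ j, (aeval T (F i j)) ∘L proj j) ∘L
    ((PiLp.continuousLinearEquiv 2 ℂ fun _ : Fin n => H) :
      (PiLp 2 fun _ : Fin n => H) →L[ℂ] (Fin n → H))

/-- The supremum norm `‖F‖_K = sup_{z ∈ K} ‖F(z)‖` of an `n × n` matrix polynomial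
over a set `K ⊆ ℂ`, where `‖F(z)‖` is the operator norm of the matrix `F(z)` on `ℂⁿ`. -/
def matPolyNorm {n : ℕ} (K : Set ℂ) (F : Matrix (Fin n) (Fin n) (Polynomial ℂ)) : ℝ :=
  sSup {r : ℝ | ∃ z ∈ K, r = ‖Matrix.toEuclideanCLM (𝕜 := ℂ) (F.map (Polynomial.eval z))‖}

open scoped ZMod in
theorem ZMod.sum_norm_sq_dft {N : ℕ} [NeZero N] {G : Type*} [NormedAddCommGroup G]
    [InnerProductSpace ℂ G] (Φ : ZMod N → G) :
    ∑ k, ‖𝓕 Φ k‖ ^ 2 = N * ∑ j, ‖Φ j‖ ^ 2 := by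
  have hinv : ∀ j, ∑ k, stdAddChar (k * j) • 𝓕 Φ k = (N : ℂ) • Φ j := by
    intro j
    have h := congrFun (LinearEquiv.symm_apply_apply (ZMod.dft (N := N) (E := G)) Φ) j
    rw [ZMod.invDFT_apply] at h
    rw [← h, smul_smul, mul_inv_cancel₀ (by exact_mod_cast NeZero.ne N), one_smul]
  have key : ∑ k, (⟪𝓕 Φ k, 𝓕 Φ k⟫_ℂ) = (N : ℂ) * ∑ j, ⟪Φ j, Φ j⟫_ℂ := by
    calc ∑ k, (⟪𝓕 Φ k, 𝓕 Φ k⟫_ℂ)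
        = ∑ k, ∑ j, ⟪Φ j, stdAddChar (k * j) • 𝓕 Φ k⟫_ℂ := by
          refine Finset.sum_congr rfl fun k _ => ?_
          conv_lhs => rw [ZMod.dft_apply, sum_inner]
          refine Finset.sum_congr rfl fun j _ => ?_
          rw [← ZMod.dft_apply, inner_smul_left, inner_smul_right, ← AddChar.map_neg_eq_conj,
            neg_neg, mul_comm j k]
      _ = ∑ j, ⟪Φ j, ∑ k, stdAddChar (k * j) • 𝓕 Φ k⟫_ℂ := by
          rw [Finset.sum_comm]
          simp_rw [inner_sum]
      _ = _ := by
          simp_rw [hinv, inner_smul_right, Finset.mul_sum]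
  simp_rw [inner_self_eq_norm_sq_to_K, Complex.coe_algebraMap] at key
  exact_mod_cast key

theorem Matrix.sum_norm_sq_sum_smul_le {m : ℕ} {G : Type*} [NormedAddCommGroup G]
    [InnerProductSpace ℂ G] (A : Matrix (Fin m) (Fin m) ℂ) (v : Fin m → G) :
    ∑ i, ‖∑ j, A i j • v j‖ ^ 2 ≤
      ‖Matrix.toEuclideanCLM (𝕜 := ℂ) A‖ ^ 2 * ∑ j, ‖v j‖ ^ 2 := by
  set S := Submodule.span ℂ (Set.range v)
  have : FiniteDimensional ℂ S := FiniteDimensional.span_of_finite ℂ (Set.finite_range v)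
  let u : Fin m → S := fun j => ⟨v j, Submodule.subset_span ⟨j, rfl⟩⟩
  let b := stdOrthonormalBasis ℂ S
  have hA : ∀ i, ‖∑ j, A i j • v j‖ = ‖∑ j, A i j • u j‖ := fun i => by
    have : ∑ j, A i j • v j = ((∑ j, A i j • u j : S) : G) := by simp [u]
    rw [this, Submodule.coe_norm]
  have hv : ∀ j, ‖v j‖ = ‖u j‖ := fun j => rfl
  simp_rw [hA, hv, ← b.sum_sq_norm_inner_right]
  rw [Finset.sum_comm, Finset.sum_comm (f := fun j l => ‖⟪b l, u j⟫_ℂ‖ ^ 2), Finset.mul_sum]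
  refine Finset.sum_le_sum fun l _ => ?_
  have h := (Matrix.toEuclideanCLM (𝕜 := ℂ) A).le_opNorm
    (WithLp.toLp 2 fun j => ⟪b l, u j⟫_ℂ)
  have h2 := pow_le_pow_left₀ (norm_nonneg _) h 2
  rw [mul_pow, EuclideanSpace.norm_sq_eq, EuclideanSpace.norm_sq_eq] at h2
  simpa [Matrix.mulVec, dotProduct, inner_sum, inner_smul_right] using h2

open scoped ZMod in
theorem sum_norm_sq_matrix_correlation_le {m N d : ℕ} [NeZero N] {G : Type*}
    [NormedAddCommGroup G] [InnerProductSpace ℂ G] {F : Matrix (Fin m) (Fin m) ℂ[X]} {c : ℝ}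
    (hF : ∀ z : ℂ, ‖z‖ = 1 → ‖Matrix.toEuclideanCLM (𝕜 := ℂ) (F.map (Polynomial.eval z))‖ ≤ c)
    (hd : ∀ i j, (F i j).natDegree < d) (a : ZMod N → Fin m → G) :
    ∑ k, ∑ i, ‖∑ j, ∑ n ∈ Finset.range d, (F i j).coeff n • a (k + (n : ZMod N)) j‖ ^ 2 ≤
      c ^ 2 * ∑ k, ∑ j, ‖a k j‖ ^ 2 := by
  have hdft : ∀ i l,
      𝓕 (fun k => ∑ j, ∑ n ∈ Finset.range d, (F i j).coeff n • a (k + (n : ZMod N)) j) l =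
        ∑ j, (F.map (Polynomial.eval (ZMod.stdAddChar l))) i j • 𝓕 (fun k => a k j) l := by
    intro i l
    simp_rw [ZMod.dft_apply, Finset.smul_sum]
    rw [Finset.sum_comm]
    refine Finset.sum_congr rfl fun j _ => ?_
    rw [Finset.sum_comm, ← Finset.smul_sum, Matrix.map_apply,
      Polynomial.eval_eq_sum_range' (hd i j), Finset.sum_smul]
    refine Finset.sum_congr rfl fun n _ => ?_
    rw [Finset.smul_sum, eq_comm, ← Equiv.sum_comp (Equiv.addRight (n : ZMod N))]
    refine Finset.sum_congr rfl fun k _ => ?_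
    simp only [Equiv.coe_addRight, smul_smul]
    congr 1
    rw [mul_comm _ ((F i j).coeff n), mul_right_comm, mul_assoc,
      ← AddChar.map_nsmul_eq_pow, ← AddChar.map_add_eq_mul]
    simp only [mul_comm, nsmul_eq_mul]
    ring_nf
  have hN : (0 : ℝ) < N := by exact_mod_cast Nat.pos_of_ne_zero (NeZero.ne N)
  refine le_of_mul_le_mul_left ?_ hN
  calc (N : ℝ) * ∑ k, ∑ i, ‖∑ j, ∑ n ∈ Finset.range d, (F i j).coeff n • a (k + (n : ZMod N)) j‖ ^ 2
      = ∑ l, ∑ i, ‖∑ j, (F.map (Polynomial.eval (ZMod.stdAddChar l))) i j •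
          𝓕 (fun k => a k j) l‖ ^ 2 := by
        rw [Finset.sum_comm, Finset.mul_sum, Finset.sum_comm (s := Finset.univ (α := ZMod N))]
        refine Finset.sum_congr rfl fun i _ => ?_
        rw [← ZMod.sum_norm_sq_dft]
        simp_rw [hdft]
    _ ≤ ∑ l, c ^ 2 * ∑ j, ‖𝓕 (fun k => a k j) l‖ ^ 2 := by
        refine Finset.sum_le_sum fun l _ => (Matrix.sum_norm_sq_sum_smul_le _ _).trans ?_
        gcongr
        exact hF _ (AddChar.norm_apply _ _)
    _ = N * (c ^ 2 * ∑ k, ∑ j, ‖a k j‖ ^ 2) := by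
        rw [← Finset.mul_sum, Finset.sum_comm, Finset.sum_comm (s := Finset.univ (α := ZMod N))]
        simp_rw [ZMod.sum_norm_sq_dft, ← Finset.mul_sum]
        ring

theorem ZMod.sum_range_natCast {N : ℕ} [NeZero N] {M : Type*} [AddCommMonoid M]
    (f : ZMod N → M) : ∑ k ∈ Finset.range N, f k = ∑ k, f k := by
  refine Finset.sum_nbij' (fun k => (k : ZMod N)) ZMod.val ?_ ?_ ?_ ?_ ?_
  · simp
  · intro k _
    simpa using ZMod.val_lt k
  · intro k hk
    exact ZMod.val_natCast_of_lt (Finset.mem_range.1 hk)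
  · intro k _
    exact ZMod.natCast_zmod_val k
  · simp

section

variable {H : Type*} [NormedAddCommGroup H] [InnerProductSpace ℂ H] [CompleteSpace H]

theorem ContinuousLinearMap.exists_norm_sq_eq_sub {R : H →L[ℂ] H} (hR : ‖R‖ ≤ 1) :
    ∃ D : H →L[ℂ] H, ∀ x, ‖D x‖ ^ 2 = ‖x‖ ^ 2 - ‖R x‖ ^ 2 := by
  have h0 : 0 ≤ 1 - star R * R := by
    have := CStarAlgebra.star_mul_le_algebraMap_norm_sq (a := R)
    refine sub_nonneg.2 (this.trans ?_)
    have h1 : ‖R‖ ^ 2 ≤ 1 := by nlinarith [norm_nonneg R]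
    simpa using algebraMap_mono (H →L[ℂ] H) h1
  obtain ⟨D, hD⟩ := CStarAlgebra.nonneg_iff_eq_star_mul_self.1 h0
  refine ⟨D, fun x => ?_⟩
  have h2 : ∀ A : H →L[ℂ] H, ((‖A x‖ ^ 2 : ℝ) : ℂ) = ⟪x, (star A * A) x⟫_ℂ := fun A => by
    rw [ContinuousLinearMap.star_eq_adjoint, mul_apply_eq_comp,
      ContinuousLinearMap.adjoint_inner_right, inner_self_eq_norm_sq_to_K]
    simp
  have h3 : ((‖x‖ ^ 2 : ℝ) : ℂ) = ⟪x, x⟫_ℂ := by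
    rw [inner_self_eq_norm_sq_to_K]; simp
  rw [← Complex.ofReal_inj, Complex.ofReal_sub, h2, h2, h3, ← hD]
  simp

theorem sum_norm_sq_sum_aeval_le_of_norm_lt_one {m : ℕ} {F : Matrix (Fin m) (Fin m) ℂ[X]} {c : ℝ}
    (hF : ∀ z : ℂ, ‖z‖ = 1 → ‖Matrix.toEuclideanCLM (𝕜 := ℂ) (F.map (Polynomial.eval z))‖ ≤ c)
    {R : H →L[ℂ] H} (hR : ‖R‖ < 1) (x : Fin m → H) :
    ∑ i, ‖∑ j, aeval R (F i j) (x j)‖ ^ 2 ≤ c ^ 2 * ∑ j, ‖x j‖ ^ 2 := by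
  obtain ⟨D, hD⟩ := ContinuousLinearMap.exists_norm_sq_eq_sub hR.le
  obtain ⟨d, hd⟩ : ∃ d, ∀ i j, (F i j).natDegree < d :=
    ⟨(Finset.univ.sup fun i => Finset.univ.sup fun j => (F i j).natDegree) + 1, fun i j =>
      Nat.lt_succ_of_le <| (Finset.le_sup (f := fun j => (F i j).natDegree)
        (Finset.mem_univ j)).trans (Finset.le_sup
          (f := fun i => Finset.univ.sup fun j => (F i j).natDegree) (Finset.mem_univ i))⟩
  set w : Fin m → H := fun i => ∑ j, aeval R (F i j) (x j) with hw
  have htel : ∀ (N : ℕ) (y : H),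
      ∑ k ∈ Finset.range N, ‖D ((R ^ k) y)‖ ^ 2 = ‖y‖ ^ 2 - ‖(R ^ N) y‖ ^ 2 := fun N y => by
    have := Finset.sum_range_sub' (fun k => ‖(R ^ k) y‖ ^ 2) N
    simp only [pow_zero, one_apply_eq_self] at this
    rw [← this]
    refine Finset.sum_congr rfl fun k _ => ?_
    rw [hD, pow_succ' R, mul_apply_eq_comp]
  have hbound : ∀ N : ℕ, ∑ i, (‖w i‖ ^ 2 - ‖(R ^ N) (w i)‖ ^ 2) ≤ c ^ 2 * ∑ j, ‖x j‖ ^ 2 := by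
    intro N
    rcases Nat.eq_zero_or_pos N with rfl | hN
    · simp only [pow_zero, one_apply_eq_self, sub_self, Finset.sum_const_zero]
      positivity
    have : NeZero (N + d) := ⟨by omega⟩
    have h := sum_norm_sq_matrix_correlation_le hF hd
      (fun (k : ZMod (N + d)) j => D ((R ^ k.val) (x j)))
    have hshift : ∀ k ∈ Finset.range N, ∀ i,
        ∑ j, ∑ n ∈ Finset.range d, (F i j).coeff n •
          D ((R ^ ((k : ZMod (N + d)) + (n : ZMod (N + d))).val) (x j)) = D ((R ^ k) (w i)) := by
      intro k hk i
      rw [hw, map_sum, map_sum]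
      refine Finset.sum_congr rfl fun j _ => ?_
      rw [Polynomial.aeval_eq_sum_range' (hd i j), _root_.sum_apply, map_sum, map_sum]
      refine Finset.sum_congr rfl fun n hn => ?_
      rw [Finset.mem_range] at hk hn
      rw [← Nat.cast_add, ZMod.val_natCast_of_lt (by omega), _root_.smul_apply,
        map_smul, map_smul, pow_add, mul_apply_eq_comp]
    calc ∑ i, (‖w i‖ ^ 2 - ‖(R ^ N) (w i)‖ ^ 2)
        = ∑ k ∈ Finset.range N, ∑ i, ‖D ((R ^ k) (w i))‖ ^ 2 := by
          simp_rw [← htel]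
          rw [Finset.sum_comm]
      _ = ∑ k ∈ Finset.range N, ∑ i, ‖∑ j, ∑ n ∈ Finset.range d, (F i j).coeff n •
          D ((R ^ ((k : ZMod (N + d)) + (n : ZMod (N + d))).val) (x j))‖ ^ 2 :=
          Finset.sum_congr rfl fun k hk => by simp_rw [hshift k hk]
      _ ≤ _ := Finset.sum_le_sum_of_subset_of_nonneg
          (Finset.range_mono (Nat.le_add_right N d)) fun _ _ _ => by positivity
      _ = _ := ZMod.sum_range_natCast (fun k : ZMod (N + d) =>
          ∑ i, ‖∑ j, ∑ n ∈ Finset.range d, (F i j).coeff n •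
            D ((R ^ (k + (n : ZMod (N + d))).val) (x j))‖ ^ 2)
      _ ≤ _ := h
      _ ≤ c ^ 2 * ∑ j, ‖x j‖ ^ 2 := by
        gcongr
        rw [← ZMod.sum_range_natCast, Finset.sum_comm]
        refine Finset.sum_le_sum fun j _ => ?_
        rw [Finset.sum_congr rfl (g := fun k => ‖D ((R ^ k) (x j))‖ ^ 2), htel]
        · exact sub_le_self _ (sq_nonneg _)
        · intro k hk
          rw [ZMod.val_natCast_of_lt (Finset.mem_range.1 hk)]
  have hlim : ∀ y : H, Filter.Tendsto (fun N : ℕ => (R ^ N) y) Filter.atTop (nhds 0) := fun y => by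
    have h := tendsto_pow_atTop_nhds_zero_of_norm_lt_one hR
    have h2 := ((ContinuousLinearMap.apply ℂ H y).continuous.tendsto 0).comp h
    rwa [map_zero] at h2
  have hlim2 : Filter.Tendsto (fun N : ℕ => ∑ i, (‖w i‖ ^ 2 - ‖(R ^ N) (w i)‖ ^ 2))
      Filter.atTop (nhds (∑ i, ‖w i‖ ^ 2)) := by
    refine tendsto_finsetSum _ fun i _ => ?_
    simpa using (((hlim (w i)).norm.pow 2).const_sub (‖w i‖ ^ 2))
  exact le_of_tendsto' hlim2 hbound

/-- The matrix-valued von Neumann inequality. -/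
theorem sum_norm_sq_sum_aeval_le {m : ℕ} {F : Matrix (Fin m) (Fin m) ℂ[X]} {c : ℝ}
    (hF : ∀ z : ℂ, ‖z‖ = 1 → ‖Matrix.toEuclideanCLM (𝕜 := ℂ) (F.map (Polynomial.eval z))‖ ≤ c)
    {R : H →L[ℂ] H} (hR : ‖R‖ ≤ 1) (x : Fin m → H) :
    ∑ i, ‖∑ j, aeval R (F i j) (x j)‖ ^ 2 ≤ c ^ 2 * ∑ j, ‖x j‖ ^ 2 := by
  have hcont : Continuous fun r : ℝ =>
      ∑ i, ‖∑ j, aeval ((r : ℂ) • R) (F i j) (x j)‖ ^ 2 := by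
    have h : ∀ i j, Continuous fun r : ℝ => aeval ((r : ℂ) • R) (F i j) (x j) := fun i j =>
      ((ContinuousLinearMap.apply ℂ H (x j)).continuous.comp
        ((F i j).continuous_aeval.comp (by fun_prop : Continuous fun r : ℝ => (r : ℂ) • R)))
    fun_prop
  have hlim := (hcont.tendsto 1).mono_left (nhdsWithin_le_nhds (s := Set.Iio 1))
  simp only [Complex.ofReal_one, one_smul] at hlim
  refine le_of_tendsto hlim ?_
  filter_upwards [Ioo_mem_nhdsLT (show (0 : ℝ) < 1 by norm_num)] with r hr
  refine sum_norm_sq_sum_aeval_le_of_norm_lt_one hF ?_ x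
  rw [norm_smul, Complex.norm_real, Real.norm_of_nonneg hr.1.le]
  nlinarith [hr.1, hr.2, norm_nonneg R]

end

theorem exists_continuous_quadratic_le {ρ : ℝ} (hρ : 1 ≤ ρ) :
    ∃ t : ℝ → ℝ, Continuous t ∧ ∀ e ∈ Set.Icc (0 : ℝ) 1,
      (max 1 (ρ ^ 2 * e) - ρ ^ 2 * e * t e) * (max 1 (ρ ^ 2 * e) - ρ ^ 2 * e * t e) +
        2 * ((max 1 (ρ ^ 2 * e) - ρ ^ 2 * e * t e) * (e * (ρ * t e))) +
        ρ * t e * (e * (ρ * t e)) ≤ max 1 (ρ ^ 2 * e) := by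
  rcases hρ.eq_or_lt with rfl | hρ
  · refine ⟨fun _ => 0, continuous_const, fun e he => ?_⟩
    rw [max_eq_left (by linarith [he.2])]
    norm_num
  · obtain ⟨k, hk⟩ : ∃ k, 2 * (ρ - 1) * k = ρ - 2 :=
      ⟨(ρ - 2) / (2 * (ρ - 1)), mul_div_cancel₀ _ (by linarith)⟩
    refine ⟨fun e => max 0 (1 + (1 - min 1 (ρ ^ 2 * e)) * k), by fun_prop, fun e he => ?_⟩
    beta_reduce
    rcases le_total 1 (ρ ^ 2 * e) with h1 | h1
    · rw [min_eq_left h1, max_eq_right h1]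
      norm_num
      nlinarith
    · rw [min_eq_right h1, max_eq_left h1]
      rcases le_total (1 + (1 - ρ ^ 2 * e) * k) 0 with h2 | h2
      · rw [max_eq_left h2]
        norm_num
      · rw [max_eq_right h2]
        obtain ⟨u, hu⟩ : ∃ u, u = 1 - ρ ^ 2 * e := ⟨_, rfl⟩
        rw [← hu] at h2 ⊢
        have hfac : (1 - ρ ^ 2 * e * (1 + u * k)) * (1 - ρ ^ 2 * e * (1 + u * k)) +
            2 * ((1 - ρ ^ 2 * e * (1 + u * k)) * (e * (ρ * (1 + u * k)))) +
            ρ * (1 + u * k) * (e * (ρ * (1 + u * k))) - 1 =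
            -(ρ * e * (1 + u * k) * (2 * (ρ - 1)) * (u * k) ^ 2) := by
          have h3 : (1 + u * k) * (ρ * (2 - u) - 2 * (1 - u)) = 2 * (ρ - 1) * (1 - (u * k) ^ 2) := by
            linear_combination (u * (1 + u * k)) * hk
          have h4 : ρ ^ 2 * e = 1 - u := by rw [hu]; ring
          linear_combination (ρ * e * (1 + u * k)) * h3 +
            (ρ * e * (1 + u * k) ^ 2 * (ρ - 2)) * h4
        have h0 : 0 ≤ ρ * e * (1 + u * k) * (2 * (ρ - 1)) * (u * k) ^ 2 := by
          have := he.1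
          have : 0 < ρ - 1 := sub_pos.2 hρ
          positivity
        linarith

section

variable {H : Type*} [NormedAddCommGroup H] [InnerProductSpace ℂ H] [CompleteSpace H]

theorem re_inner_cfc_apply_cfc_apply {E : H →L[ℂ] H} {f g : ℝ → ℝ} (hf : Continuous f)
    (hg : Continuous g) (z : H) :
    (⟪cfc f E z, cfc g E z⟫_ℂ).re = (⟪z, cfc (fun e => f e * g e) E z⟫_ℂ).re := by
  rw [cfc_mul f g E hf.continuousOn hg.continuousOn, mul_apply_eq_comp,
    ← ContinuousLinearMap.adjoint_inner_left (cfc f E), ← ContinuousLinearMap.star_eq_adjoint,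
    (cfc_predicate f E : IsSelfAdjoint _).star_eq]

theorem norm_sq_cfc_apply {E : H →L[ℂ] H} {f : ℝ → ℝ} (hf : Continuous f) (z : H) :
    ‖cfc f E z‖ ^ 2 = (⟪z, cfc (fun e => f e * f e) E z⟫_ℂ).re := by
  rw [← re_inner_cfc_apply_cfc_apply hf hf, ← inner_self_eq_norm_sq (𝕜 := ℂ)]
  rfl

theorem spectrum_subset_Icc_of_nonneg_of_le_one {E : H →L[ℂ] H} (h0 : 0 ≤ E) (h1 : E ≤ 1) :
    spectrum ℝ E ⊆ Set.Icc 0 1 := fun e he =>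
  ⟨spectrum_nonneg_of_nonneg h0 he,
    (le_algebraMap_iff_spectrum_le (r := (1 : ℝ)) (a := E) (IsSelfAdjoint.of_nonneg h0)).1
      (by simpa using h1) e he⟩

theorem re_inner_cfc_apply_mono {E : H →L[ℂ] H} (h0 : 0 ≤ E) (h1 : E ≤ 1) {f g : ℝ → ℝ}
    (hf : Continuous f) (hg : Continuous g) (hfg : ∀ e ∈ Set.Icc (0 : ℝ) 1, f e ≤ g e) (z : H) :
    (⟪z, cfc f E z⟫_ℂ).re ≤ (⟪z, cfc g E z⟫_ℂ).re := by
  have h : cfc f E ≤ cfc g E :=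
    cfc_mono (fun e he => hfg e (spectrum_subset_Icc_of_nonneg_of_le_one h0 h1 he))
      hf.continuousOn hg.continuousOn
  have h2 := ((ContinuousLinearMap.le_def _ _).1 h).re_inner_nonneg_right z
  simpa [inner_sub_right] using h2

theorem re_inner_cfc_add {E : H →L[ℂ] H} {f g : ℝ → ℝ} (hf : Continuous f) (hg : Continuous g)
    (z : H) : (⟪z, cfc (fun e => f e + g e) E z⟫_ℂ).re =
      (⟪z, cfc f E z⟫_ℂ).re + (⟪z, cfc g E z⟫_ℂ).re := by
  rw [cfc_add E f g hf.continuousOn hg.continuousOn, add_apply, inner_add_right, Complex.add_re]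

theorem re_inner_cfc_const_mul {E : H →L[ℂ] H} {f : ℝ → ℝ} (hf : Continuous f) (c : ℝ)
    (z : H) : (⟪z, cfc (fun e => c * f e) E z⟫_ℂ).re = c * (⟪z, cfc f E z⟫_ℂ).re := by
  rw [cfc_const_mul c f E hf.continuousOn, _root_.smul_apply,
    RCLike.real_smul_eq_coe_smul (K := ℂ), inner_smul_right]
  simp

theorem exists_similarity_of_norm_sq_inner_le {T E : H →L[ℂ] H} {ρ : ℝ} (hρ : 1 ≤ ρ)
    (h0 : 0 ≤ E) (h1 : E ≤ 1)
    (hkey : ∀ y h g : H, ‖⟪y, T (h + (ρ : ℂ) • E g)⟫_ℂ‖ ^ 2 ≤ ρ ^ 2 * (⟪y, E y⟫_ℂ).re *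
      (‖h‖ ^ 2 + 2 * (⟪h, E g⟫_ℂ).re + (⟪g, E g⟫_ℂ).re)) :
    ∃ S S' : H →L[ℂ] H, IsSelfAdjoint S ∧ S * S' = 1 ∧ S' * S = 1 ∧ ‖S' * T * S‖ ≤ 1 ∧
      ∀ x, ‖S x‖ ^ 2 + ρ ^ 2 * ‖S' x‖ ^ 2 ≤ (1 + ρ ^ 2) * ‖x‖ ^ 2 := by
  obtain ⟨t, ht, hquad⟩ := exists_continuous_quadratic_le hρ
  have hEsa : IsSelfAdjoint E := IsSelfAdjoint.of_nonneg h0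
  set φ : ℝ → ℝ := fun e => max 1 (ρ ^ 2 * e) with hφ
  set σ : ℝ → ℝ := fun e => √(φ e) with hσ
  set τ : ℝ → ℝ := fun e => (σ e)⁻¹ with hτ
  set a : ℝ → ℝ := fun e => φ e - ρ ^ 2 * e * t e with ha
  set g : ℝ → ℝ := fun e => ρ * t e with hg
  have hφ1 : ∀ e, 1 ≤ φ e := fun e => le_max_left _ _
  have hφ0 : ∀ e, 0 ≤ φ e := fun e => zero_le_one.trans (hφ1 e)
  have hσ0 : ∀ e, 0 < σ e := fun e => Real.sqrt_pos.2 (zero_lt_one.trans_le (hφ1 e))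
  have hσσ : (fun e => σ e * σ e) = φ := funext fun e => Real.mul_self_sqrt (hφ0 e)
  have cφ : Continuous φ := by fun_prop
  have cσ : Continuous σ := by fun_prop
  have cτ : Continuous τ := cσ.inv₀ fun e => (hσ0 e).ne'
  have ca : Continuous a := by fun_prop
  have cg : Continuous g := by fun_prop
  have hS : IsSelfAdjoint (cfc σ E) := cfc_predicate σ E
  have hS' : IsSelfAdjoint (cfc τ E) := cfc_predicate τ E
  have hmul : cfc σ E * cfc τ E = 1 := by
    rw [← cfc_mul σ τ E cσ.continuousOn cτ.continuousOn, ← cfc_one ℝ E]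
    exact cfc_congr fun e _ => mul_inv_cancel₀ (hσ0 e).ne'
  have hmul' : cfc τ E * cfc σ E = 1 := by
    rw [← cfc_mul τ σ E cτ.continuousOn cσ.continuousOn, ← cfc_one ℝ E]
    exact cfc_congr fun e _ => inv_mul_cancel₀ (hσ0 e).ne'
  have hEid : ∀ f : ℝ → ℝ, Continuous f → ∀ z, E (cfc f E z) = cfc (fun e => e * f e) E z := by
    intro f hf z
    rw [cfc_mul (fun e => e) f E continuousOn_id hf.continuousOn, cfc_id' ℝ E, mul_apply_eq_comp]
  have hSadj : ∀ y, ‖cfc σ E (adjoint T y)‖ ≤ ‖cfc σ E y‖ := by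
    intro y
    set z := adjoint T y with hz
    have hφz : cfc a E z + (ρ : ℂ) • E (cfc g E z) = cfc φ E z := by
      rw [hEid g cg, Complex.coe_smul, ← _root_.smul_apply,
        ← cfc_const_mul ρ (fun e => e * g e) E (by fun_prop), ← add_apply,
        ← cfc_add E a (fun e => ρ * (e * g e)) (by fun_prop) (by fun_prop)]
      congr 2
      funext e
      simp only [ha, hg]
      ring
    have hl : ‖cfc σ E z‖ ^ 2 ≤ ‖⟪y, T (cfc φ E z)⟫_ℂ‖ := by
      rw [norm_sq_cfc_apply cσ, hσσ, ← ContinuousLinearMap.adjoint_inner_left T]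
      exact Complex.re_le_norm _
    have hr : ‖cfc a E z‖ ^ 2 + 2 * (⟪cfc a E z, E (cfc g E z)⟫_ℂ).re +
        (⟪cfc g E z, E (cfc g E z)⟫_ℂ).re ≤ ‖cfc σ E z‖ ^ 2 := by
      rw [norm_sq_cfc_apply cσ, hσσ, norm_sq_cfc_apply ca, hEid g cg,
        re_inner_cfc_apply_cfc_apply ca (by fun_prop), re_inner_cfc_apply_cfc_apply cg (by fun_prop),
        ← re_inner_cfc_const_mul (by fun_prop), ← re_inner_cfc_add (by fun_prop) (by fun_prop),
        ← re_inner_cfc_add (by fun_prop) (by fun_prop)]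
      exact re_inner_cfc_apply_mono h0 h1 (by fun_prop) cφ hquad z
    have hy : ρ ^ 2 * (⟪y, E y⟫_ℂ).re ≤ ‖cfc σ E y‖ ^ 2 := by
      rw [norm_sq_cfc_apply cσ, hσσ]
      nth_rewrite 1 [← cfc_id' ℝ E]
      rw [← re_inner_cfc_const_mul (by fun_prop)]
      exact re_inner_cfc_apply_mono h0 h1 (by fun_prop) cφ (fun e _ => le_max_right _ _) y
    have hk := hkey y (cfc a E z) (cfc g E z)
    rw [hφz] at hk
    have hEy : 0 ≤ (⟪y, E y⟫_ℂ).re :=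
      ((ContinuousLinearMap.nonneg_iff_isPositive E).1 h0).re_inner_nonneg_right y
    have h2 : (‖cfc σ E z‖ ^ 2) ^ 2 ≤ ‖cfc σ E y‖ ^ 2 * ‖cfc σ E z‖ ^ 2 := by
      calc (‖cfc σ E z‖ ^ 2) ^ 2 ≤ ‖⟪y, T (cfc φ E z)⟫_ℂ‖ ^ 2 := by gcongr
        _ ≤ _ := hk
        _ ≤ ρ ^ 2 * (⟪y, E y⟫_ℂ).re * ‖cfc σ E z‖ ^ 2 := by gcongr
        _ ≤ _ := by gcongr
    rcases (norm_nonneg (cfc σ E z)).eq_or_lt with h3 | h3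
    · rw [← h3]; exact norm_nonneg _
    · refine le_of_sq_le_sq ?_ (norm_nonneg _)
      have : 0 < ‖cfc σ E z‖ ^ 2 := by positivity
      nlinarith
  refine ⟨cfc σ E, cfc τ E, hS, hmul, hmul', ?_, fun x => ?_⟩
  · rw [← norm_star, star_mul, star_mul, hS.star_eq, hS'.star_eq]
    refine ContinuousLinearMap.opNorm_le_bound _ zero_le_one fun y => ?_
    rw [mul_apply_eq_comp, mul_apply_eq_comp, one_mul, ContinuousLinearMap.star_eq_adjoint]
    refine (hSadj _).trans_eq ?_
    rw [← mul_apply_eq_comp, hmul, one_apply_eq_self]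
  · have hx : ‖x‖ ^ 2 = (⟪x, cfc (fun _ => (1 : ℝ)) E x⟫_ℂ).re := by
      rw [cfc_const_one ℝ E, one_apply_eq_self, ← inner_self_eq_norm_sq (𝕜 := ℂ)]
      rfl
    rw [norm_sq_cfc_apply cσ, hσσ, norm_sq_cfc_apply cτ, hx,
      ← re_inner_cfc_const_mul (by fun_prop), ← re_inner_cfc_const_mul (by fun_prop),
      ← re_inner_cfc_add (by fun_prop) (by fun_prop)]
    refine re_inner_cfc_apply_mono h0 h1 (by fun_prop) (by fun_prop) (fun e he => ?_) x
    have h3 : τ e * τ e = (φ e)⁻¹ := by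
      rw [← hσσ]; simp [hτ]
    have h4 : φ e ≤ ρ ^ 2 := max_le (by nlinarith) (by nlinarith [he.2, sq_nonneg ρ])
    have h5 : 0 < φ e := zero_lt_one.trans_le (hφ1 e)
    rw [h3, mul_one]
    rw [← sub_nonneg]
    have h6 : (1 + ρ ^ 2) - (φ e + ρ ^ 2 * (φ e)⁻¹) = (φ e - 1) * (ρ ^ 2 - φ e) * (φ e)⁻¹ := by
      field_simp
      ring
    rw [h6]
    exact mul_nonneg (mul_nonneg (sub_nonneg.2 (hφ1 e)) (sub_nonneg.2 h4)) (inv_nonneg.2 h5.le)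

end

theorem adjoint_comp_starProjection_comp_mem_Icc {H K : Type*} [NormedAddCommGroup H]
    [InnerProductSpace ℂ H] [CompleteSpace H] [NormedAddCommGroup K] [InnerProductSpace ℂ K]
    [CompleteSpace K] {V : H →L[ℂ] K} (hV : Isometry V) (L : Submodule ℂ K)
    [L.HasOrthogonalProjection] :
    adjoint V ∘L L.starProjection ∘L V ∈ Set.Icc 0 1 := by
  have hP : IsStarProjection L.starProjection := isStarProjection_starProjection
  have hVV : adjoint V ∘L V = 1 :=
    (ContinuousLinearMap.norm_map_iff_adjoint_comp_self V).1
      (hV.norm_map_of_map_zero (map_zero V))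
  constructor
  · rw [ContinuousLinearMap.nonneg_iff_isPositive]
    exact ((ContinuousLinearMap.nonneg_iff_isPositive _).1 hP.nonneg).adjoint_conj V
  · rw [ContinuousLinearMap.le_def, ← hVV]
    have h := ((ContinuousLinearMap.le_def _ _).1 hP.le_one).adjoint_conj V
    convert h using 1
    ext x
    simp

theorem exists_norm_sq_inner_le_of_rho_dilation {H K : Type*} [NormedAddCommGroup H]
    [InnerProductSpace ℂ H] [CompleteSpace H] [NormedAddCommGroup K] [InnerProductSpace ℂ K]
    [CompleteSpace K] {T : H →L[ℂ] H} {ρ : ℝ} {V : H →L[ℂ] K} (hV : Isometry V) {U : K →L[ℂ] K}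
    (hU : U ∈ unitary (K →L[ℂ] K))
    (hdil : ∀ n : ℕ, 1 ≤ n → T ^ n = (ρ : ℂ) • (adjoint V ∘L (U ^ n) ∘L V)) :
    ∃ E : H →L[ℂ] H, 0 ≤ E ∧ E ≤ 1 ∧
      ∀ y h g : H, ‖⟪y, T (h + (ρ : ℂ) • E g)⟫_ℂ‖ ^ 2 ≤ ρ ^ 2 * (⟪y, E y⟫_ℂ).re *
        (‖h‖ ^ 2 + 2 * (⟪h, E g⟫_ℂ).re + (⟪g, E g⟫_ℂ).re) := by
  set L : Submodule ℂ K := (Submodule.span ℂ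
    {k : K | ∃ (n : ℕ) (h : H), k = (U ^ (n + 1)) (V h)}).topologicalClosure with hL
  have : CompleteSpace L := (Submodule.isClosed_topologicalClosure _).completeSpace_coe
  set P := L.starProjection with hP
  obtain ⟨h0, h1⟩ := adjoint_comp_starProjection_comp_mem_Icc hV L
  refine ⟨_, h0, h1, fun y h g => ?_⟩
  have hVn : ∀ x, ‖V x‖ = ‖x‖ := hV.norm_map_of_map_zero (map_zero V)
  have hUn : ∀ x, ‖U x‖ = ‖x‖ :=
    (ContinuousLinearMap.norm_map_iff_adjoint_comp_self U).2 (Unitary.star_mul_self_of_mem hU)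
  have hgen : ∀ (n : ℕ) (h : H), (U ^ (n + 1)) (V h) ∈ L := fun n h =>
    Submodule.le_topologicalClosure _ (Submodule.subset_span ⟨n, h, rfl⟩)
  have hT : ∀ (n : ℕ) (h : H), (T ^ (n + 1)) h = (ρ : ℂ) • adjoint V ((U ^ (n + 1)) (V h)) :=
    fun n h => by rw [hdil (n + 1) (by omega)]; rfl
  have hind : ∀ l ∈ L, U l ∈ L ∧ (ρ : ℂ) • adjoint V (U l) = T ((ρ : ℂ) • adjoint V l) := by
    intro l hl
    let Q : Submodule ℂ K := L.comap (U : K →ₗ[ℂ] K) ⊓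
      LinearMap.eqLocus (((ρ : ℂ) • (adjoint V ∘L U) : K →L[ℂ] H) : K →ₗ[ℂ] H)
        ((T ∘L ((ρ : ℂ) • adjoint V) : K →L[ℂ] H) : K →ₗ[ℂ] H)
    have hQ : IsClosed (Q : Set K) :=
      ((Submodule.isClosed_topologicalClosure _).preimage U.continuous).inter
        (isClosed_eq ((ρ : ℂ) • (adjoint V ∘L U) : K →L[ℂ] H).continuous
          (T ∘L ((ρ : ℂ) • adjoint V) : K →L[ℂ] H).continuous)
    have hLQ : L ≤ Q := by
      refine Submodule.topologicalClosure_minimal _ (Submodule.span_le.2 ?_) hQ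
      rintro _ ⟨n, h, rfl⟩
      have hpow : U ((U ^ (n + 1)) (V h)) = (U ^ (n + 1 + 1)) (V h) := by
        rw [pow_succ' U (n + 1), mul_apply_eq_comp]
      refine ⟨?_, ?_⟩
      · change U _ ∈ L
        rw [hpow]
        exact hgen _ _
      · change (ρ : ℂ) • adjoint V (U ((U ^ (n + 1)) (V h))) = T ((ρ : ℂ) • adjoint V _)
        rw [hpow, ← hT, ← hT, pow_succ' T (n + 1), mul_apply_eq_comp]
    exact hLQ hl
  have hPg : P (V g) ∈ L := L.starProjection_apply_mem _
  set l := V h + P (V g) with hl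
  have hUl : U l ∈ L := by
    rw [hl, map_add]
    exact L.add_mem (by simpa using hgen 0 h) (hind _ hPg).1
  have hTl : T (h + (ρ : ℂ) • (adjoint V ∘L P ∘L V) g) = (ρ : ℂ) • adjoint V (U l) := by
    rw [hl, map_add, map_add, map_add, smul_add, (hind _ hPg).2]
    congr 1
    simpa using hT 0 h
  have hPP : ∀ a b : K, ⟪P a, P b⟫_ℂ = ⟪a, P b⟫_ℂ := fun a b => by
    rw [hP, Submodule.inner_starProjection_left_eq_right,
      Submodule.starProjection_eq_self_iff.2 (L.starProjection_apply_mem b)]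
  have hE : ∀ a b : H, ⟪a, (adjoint V ∘L P ∘L V) b⟫_ℂ = ⟪V a, P (V b)⟫_ℂ := fun a b => by
    simp [ContinuousLinearMap.adjoint_inner_right]
  have hPn : ∀ a : K, (⟪a, P a⟫_ℂ).re = ‖P a‖ ^ 2 := fun a => by
    rw [← hPP, ← inner_self_eq_norm_sq (𝕜 := ℂ)]
    rfl
  have hinner : ⟪y, T (h + (ρ : ℂ) • (adjoint V ∘L P ∘L V) g)⟫_ℂ = ρ * ⟪P (V y), U l⟫_ℂ := by
    rw [hTl, inner_smul_right, ContinuousLinearMap.adjoint_inner_right, hP,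
      Submodule.inner_starProjection_left_eq_right, Submodule.starProjection_eq_self_iff.2 hUl]
  have hnorm : ‖h‖ ^ 2 + 2 * (⟪V h, P (V g)⟫_ℂ).re + ‖P (V g)‖ ^ 2 = ‖l‖ ^ 2 := by
    rw [hl, norm_add_sq (𝕜 := ℂ), hVn]
    rfl
  rw [hinner, hE, hE, hE, hPn, hPn, hnorm, norm_mul, mul_pow, Complex.norm_real, Real.norm_eq_abs,
    sq_abs]
  have hCS : ‖⟪P (V y), U l⟫_ℂ‖ ^ 2 ≤ (‖P (V y)‖ * ‖l‖) ^ 2 := by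
    rw [← hUn l]
    exact pow_le_pow_left₀ (norm_nonneg _) (norm_inner_le_norm _ _) 2
  calc ρ ^ 2 * ‖⟪P (V y), U l⟫_ℂ‖ ^ 2 ≤ ρ ^ 2 * (‖P (V y)‖ * ‖l‖) ^ 2 := by gcongr
    _ = _ := by ring

section

variable {H : Type*} [NormedAddCommGroup H] [InnerProductSpace ℂ H]

theorem Polynomial.aeval_mul_eq_mul_aeval {A : Type*} [Ring A] [Algebra ℂ A] {T R S : A}
    (h : T * S = S * R) (p : ℂ[X]) : aeval T p * S = S * aeval R p := by
  induction p using Polynomial.induction_on' with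
  | add p q hp hq => rw [map_add, map_add, add_mul, mul_add, hp, hq]
  | monomial n a =>
    have hpow : T ^ n * S = S * R ^ n :=
      (SemiconjBy.pow_right (show SemiconjBy S R T from h.symm) n).eq.symm
    rw [aeval_monomial, aeval_monomial, mul_assoc, hpow, ← mul_assoc, Algebra.commutes, mul_assoc]

theorem matPolyEval_apply {m : ℕ} (T : H →L[ℂ] H) (F : Matrix (Fin m) (Fin m) ℂ[X])
    (x : PiLp 2 fun _ : Fin m => H) (i : Fin m) :
    matPolyEval T F x i = ∑ j, aeval T (F i j) (x j) := by
  simp [matPolyEval]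

end

theorem norm_toEuclideanCLM_map_eval_le_matPolyNorm {m : ℕ} (F : Matrix (Fin m) (Fin m) ℂ[X])
    {K : Set ℂ} (hK : IsCompact K) {z : ℂ} (hz : z ∈ K) :
    ‖Matrix.toEuclideanCLM (𝕜 := ℂ) (F.map (Polynomial.eval z))‖ ≤ matPolyNorm K F := by
  have hcont : Continuous fun z : ℂ =>
      ‖Matrix.toEuclideanCLM (𝕜 := ℂ) (F.map (Polynomial.eval z))‖ := by
    have h1 : Continuous fun z : ℂ => F.map (Polynomial.eval z) :=
      continuous_matrix fun i j => (F i j).continuous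
    have h2 : Continuous (Matrix.toEuclideanCLM (n := Fin m) (𝕜 := ℂ)) :=
      LinearMap.continuous_of_finiteDimensional
        (Matrix.toEuclideanCLM (n := Fin m) (𝕜 := ℂ)).toAlgEquiv.toLinearMap
    exact (h2.comp h1).norm
  refine le_csSup ?_ ⟨z, hz, rfl⟩
  refine (hK.image hcont).bddAbove.mono ?_
  rintro _ ⟨w, hw, rfl⟩
  exact ⟨w, hw, rfl⟩

theorem norm_inner_matPolyEval_le_of_similarity {H : Type*} [NormedAddCommGroup H]
    [InnerProductSpace ℂ H] [CompleteSpace H] {T S S' : H →L[ℂ] H} {ρ c : ℝ} (hρ : 0 < ρ)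
    (hc : 0 ≤ c) (hS : IsSelfAdjoint S) (hSS' : S * S' = 1) (hR : ‖S' * T * S‖ ≤ 1)
    (hb : ∀ x, ‖S x‖ ^ 2 + ρ ^ 2 * ‖S' x‖ ^ 2 ≤ (1 + ρ ^ 2) * ‖x‖ ^ 2) {m : ℕ}
    {F : Matrix (Fin m) (Fin m) ℂ[X]}
    (hF : ∀ z : ℂ, ‖z‖ = 1 → ‖Matrix.toEuclideanCLM (𝕜 := ℂ) (F.map (Polynomial.eval z))‖ ≤ c)
    (x : PiLp 2 fun _ : Fin m => H) :
    ‖⟪x, matPolyEval T F x⟫_ℂ‖ ≤ 1 / 2 * (ρ + ρ⁻¹) * c * ‖x‖ ^ 2 := by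
  set R := S' * T * S with hRdef
  have hTS : T * S = S * R := by
    rw [hRdef, ← mul_assoc, ← mul_assoc, hSS', one_mul]
  let u : PiLp 2 fun _ : Fin m => H := WithLp.toLp 2 fun i => S (x i)
  let v : PiLp 2 fun _ : Fin m => H := WithLp.toLp 2 fun i => S' (x i)
  let w : PiLp 2 fun _ : Fin m => H := WithLp.toLp 2 fun i => ∑ j, aeval R (F i j) (v j)
  have hinner : ⟪x, matPolyEval T F x⟫_ℂ = ⟪u, w⟫_ℂ := by
    rw [PiLp.inner_apply, PiLp.inner_apply]
    refine Finset.sum_congr rfl fun i _ => ?_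
    have h : matPolyEval T F x i = S (w i) := by
      rw [matPolyEval_apply, map_sum]
      refine Finset.sum_congr rfl fun j _ => ?_
      change _ = S (aeval R (F i j) (S' (x j)))
      rw [← mul_apply_eq_comp, ← Polynomial.aeval_mul_eq_mul_aeval hTS, mul_apply_eq_comp,
        ← mul_apply_eq_comp S S', hSS', one_apply_eq_self]
    rw [h, ← ContinuousLinearMap.adjoint_inner_left, ← ContinuousLinearMap.star_eq_adjoint,
      hS.star_eq]
  have hw : ‖w‖ ≤ c * ‖v‖ := by
    refine le_of_sq_le_sq ?_ (by positivity)
    rw [mul_pow, PiLp.norm_sq_eq_of_L2, PiLp.norm_sq_eq_of_L2]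
    exact sum_norm_sq_sum_aeval_le hF hR fun i => v i
  have huv : ‖u‖ ^ 2 + ρ ^ 2 * ‖v‖ ^ 2 ≤ (1 + ρ ^ 2) * ‖x‖ ^ 2 := by
    rw [PiLp.norm_sq_eq_of_L2, PiLp.norm_sq_eq_of_L2, PiLp.norm_sq_eq_of_L2, Finset.mul_sum,
      Finset.mul_sum, ← Finset.sum_add_distrib]
    exact Finset.sum_le_sum fun i _ => hb (x i)
  have huv' : ‖u‖ * ‖v‖ ≤ 1 / 2 * (ρ + ρ⁻¹) * ‖x‖ ^ 2 := by
    refine le_of_mul_le_mul_left ?_ hρ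
    have h : ρ * (1 / 2 * (ρ + ρ⁻¹) * ‖x‖ ^ 2) = 1 / 2 * ((1 + ρ ^ 2) * ‖x‖ ^ 2) := by
      field_simp
      ring
    rw [h]
    nlinarith [sq_nonneg (‖u‖ - ρ * ‖v‖)]
  calc ‖⟪x, matPolyEval T F x⟫_ℂ‖ = ‖⟪u, w⟫_ℂ‖ := by rw [hinner]
    _ ≤ ‖u‖ * ‖w‖ := norm_inner_le_norm _ _
    _ ≤ ‖u‖ * (c * ‖v‖) := by gcongr
    _ = c * (‖u‖ * ‖v‖) := by ring
    _ ≤ c * (1 / 2 * (ρ + ρ⁻¹) * ‖x‖ ^ 2) := by gcongr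
    _ = _ := by ring

/-- If `T` is a `ρ`-contraction (it admits a unitary `ρ`-dilation), then
`w(F(T)) ≤ (1/2)(ρ + ρ⁻¹)·‖F‖_{D̄}` for every matrix polynomial `F`. -/
theorem numRadius_matPolyEval_le_of_rho_dilation {H : Type*} [NormedAddCommGroup H]
    [InnerProductSpace ℂ H] [CompleteSpace H] {K : Type*} [NormedAddCommGroup K]
    [InnerProductSpace ℂ K] [CompleteSpace K] (T : H →L[ℂ] H) (ρ : ℝ) (hρ : 1 ≤ ρ)
    (V : H →L[ℂ] K) (hV : Isometry V) (U : K →L[ℂ] K)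
    (hU : U ∈ unitary (K →L[ℂ] K))
    (hdil : ∀ n : ℕ, 1 ≤ n →
      T ^ n = (ρ : ℂ) • (ContinuousLinearMap.adjoint V ∘L (U ^ n) ∘L V)) :
    ∀ m : ℕ, 1 ≤ m → ∀ F : Matrix (Fin m) (Fin m) (Polynomial ℂ),
      numRadius (matPolyEval T F) ≤
        (1 / 2) * (ρ + ρ⁻¹) * matPolyNorm (Metric.closedBall (0 : ℂ) 1) F := by
  intro m _ F
  obtain ⟨E, h0, h1, hkey⟩ := exists_norm_sq_inner_le_of_rho_dilation hV hU hdil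
  obtain ⟨S, S', hS, hSS', -, hR, hb⟩ := exists_similarity_of_norm_sq_inner_le hρ h0 h1 hkey
  have hρ0 : 0 < ρ := zero_lt_one.trans_le hρ
  have hc : 0 ≤ matPolyNorm (Metric.closedBall (0 : ℂ) 1) F := by
    refine Real.sSup_nonneg ?_
    rintro _ ⟨z, _, rfl⟩
    exact norm_nonneg _
  refine Real.sSup_le ?_ (by positivity)
  rintro _ ⟨x, hx, rfl⟩
  have h := norm_inner_matPolyEval_le_of_similarity hρ0 hc hS hSS' hR hb (F := F)
    (fun z hz => norm_toEuclideanCLM_map_eval_le_matPolyNorm F (isCompact_closedBall 0 1)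
      (by simp [hz])) x
  rwa [hx, one_pow, mul_one] at h

end
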